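/- Let L, p, l be positive integers with 1 ≤ l ≤ L, and set t = 2L + 2 + p − l. Let s, r be integers with 0 ≤ s < r < 2^L such that r does not divide 2^{l+1}·s, and set ω̂ = Bits(s/r, l, 2L+1+p). Let m be an integer with 0 ≤ m < 2^t such that d_t(m, ω̂) < 2^p. Then |m − ω̂| < 2^p and ⌊m / 2^{t−2}⌋ = Bits(s/r, l, l+1); that is, the error of m as an estimate of ω̂ is less than 2^p without wraparound, and the first two bits of m equal the l-th and (l+1)-th bits of the binary expansion of s/r. -/

import Mathlib

/-- `dDist t x y = min(|x - y|, 2^t - |x - y|)`. -/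
def dDist (t : ℕ) (x y : ℤ) : ℤ := min |x - y| (2 ^ t - |x - y|)

/-- `bits ω i j` is the integer whose binary digits are the `i`-th through `j`-th
bits after the binary point of the binary expansion of `ω ∈ [0,1)`. -/
noncomputable def bits (ω : ℝ) (i j : ℕ) : ℤ := ⌊(2 : ℝ) ^ j * ω⌋ % 2 ^ (j - i + 1)

theorem bits_floor_aux (s r : ℤ) (hr : 0 < r) (j : ℕ) :
    ⌊(2 : ℝ) ^ j * ((s : ℝ) / (r : ℝ))⌋ = (2 ^ j * s) / r := by
  have hr' : (0 : ℝ) < r := by exact_mod_cast hr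
  rw [Int.floor_eq_iff, ← mul_div_assoc, le_div_iff₀ hr', div_lt_iff₀ hr']
  have h1 : (2 ^ j * s) / r * r ≤ 2 ^ j * s := Int.ediv_mul_le _ hr.ne'
  have h2 : 2 ^ j * s < ((2 ^ j * s) / r + 1) * r := Int.lt_ediv_add_one_mul_self _ hr
  exact ⟨by exact_mod_cast h1, by exact_mod_cast h2⟩

theorem stmt_10 (L p l : ℕ) (hL : 0 < L) (hp : 0 < p) (hl : 1 ≤ l) (hlL : l ≤ L)
    (s r : ℤ) (hs : 0 ≤ s) (hsr : s < r) (hr : r < 2 ^ L)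
    (hnd : ¬ (r ∣ 2 ^ (l + 1) * s))
    (t : ℕ) (ht : t = 2 * L + 2 + p - l)
    (m : ℤ) (hm0 : 0 ≤ m) (hm : m < 2 ^ t)
    (hd : dDist t m (bits ((s : ℝ) / (r : ℝ)) l (2 * L + 1 + p)) < 2 ^ p) :
    |m - bits ((s : ℝ) / (r : ℝ)) l (2 * L + 1 + p)| < 2 ^ p ∧
    m / 2 ^ (t - 2) = bits ((s : ℝ) / (r : ℝ)) l (l + 1) := by
  have hr0 : 0 < r := by omega
  obtain ⟨K, hK⟩ : ∃ K, K = 2 * L + p - l := ⟨_, rfl⟩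
  have htK : t = K + 2 := by omega
  have hJ : 2 * L + 1 + p = K + (l + 1) := by omega
  have e1 : 2 * L + 1 + p - l + 1 = K + 2 := by omega
  have e2 : l + 1 - l + 1 = 2 := by omega
  have e3 : K + 2 - 2 = K := by omega
  unfold bits dDist at *
  rw [bits_floor_aux s r hr0, e1] at hd ⊢
  rw [bits_floor_aux s r hr0, e2]
  rw [hJ] at hd ⊢
  subst htK
  rw [e3]
  have hM : (2 : ℤ) ^ (L + p) ≤ 2 ^ K := pow_le_pow_right₀ (by norm_num) (by omega)
  have hP : (0 : ℤ) < 2 ^ p := by positivity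
  have hM0 : (0 : ℤ) < 2 ^ K := by positivity
  have hMr : (r + 1) * 2 ^ p ≤ 2 ^ K := by
    refine le_trans ?_ hM
    rw [pow_add]
    exact mul_le_mul_of_nonneg_right (by omega) hP.le
  have hb0 : 0 ≤ 2 ^ (l + 1) * s % r := Int.emod_nonneg _ hr0.ne'
  have hb1 : 2 ^ (l + 1) * s % r ≠ 0 := fun h => hnd (Int.dvd_of_emod_eq_zero h)
  have hb2 : 2 ^ (l + 1) * s % r < r := Int.emod_lt_of_pos _ hr0
  have hdm := Int.mul_ediv_add_emod (2 ^ (l + 1) * s) r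
  generalize 2 ^ (l + 1) * s % r = b at *
  rw [pow_add 2 K (l + 1), mul_assoc] at hd ⊢
  rw [pow_add 2 K 2] at hd hm ⊢
  generalize 2 ^ (l + 1) * s / r = A at *
  rw [← hdm] at hd ⊢
  generalize (2 : ℤ) ^ K = M at *
  generalize (2 : ℤ) ^ p = P at *
  have hN : M * (r * A + b) / r = M * A + M * b / r := by
    rw [show M * (r * A + b) = M * b + r * (M * A) by ring,
      Int.add_mul_ediv_left _ _ hr0.ne']
    ring
  rw [hN] at hd ⊢
  have hf1 : P ≤ M * b / r := by
    rw [Int.le_ediv_iff_mul_le hr0]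
    nlinarith [show 1 ≤ b by omega]
  have hf2 : M * b / r < M - P := by
    rw [Int.ediv_lt_iff_lt_mul hr0]
    nlinarith [show b ≤ r - 1 by omega]
  generalize M * b / r = f at *
  have hA := Int.mul_ediv_add_emod A 4
  have ha0 : 0 ≤ A % 4 := by omega
  have ha1 : A % 4 ≤ 3 := by omega
  have h1 : 0 ≤ M * (A % 4) := mul_nonneg hM0.le ha0
  have h2 : M * (A % 4) ≤ M * 3 := mul_le_mul_of_nonneg_left ha1 hM0.le
  have hw : (M * A + f) % (M * 2 ^ 2) = M * (A % 4) + f := by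
    rw [show M * A + f = (M * (A % 4) + f) + (M * 2 ^ 2) * (A / 4) by linear_combination (-M) * hA,
      Int.add_mul_emod_self_left]
    apply Int.emod_eq_of_lt <;> linarith
  rw [hw] at hd ⊢
  norm_num
  generalize A % 4 = a at *
  have key : |m - (M * a + f)| < P := by
    rcases min_lt_iff.mp hd with h | h
    · exact h
    · exfalso
      rcases abs_cases (m - (M * a + f)) with ⟨h3, h4⟩ | ⟨h3, h4⟩ <;> rw [h3] at h <;> linarith
  refine ⟨key, ?_⟩
  rw [abs_lt] at key
  rw [Int.ediv_eq_iff_of_pos hM0]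
  constructor <;> linarith
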